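/- For every t₀ > 0 there exists δ₀ > 0 such that for every fixed t with 0 < t ≤ t₀, the function η ↦ K_ℍ(t; η) is monotone decreasing on the interval [δ₀, ∞), where K_ℍ(t; η) = (√2 · e^{−t/4}/(4πt)^{3/2}) · ∫_η^∞ r·e^{−r²/(4t)}/√(cosh r − cosh η) dr. -/

import Mathlib

open MeasureTheory

/-- The heat kernel on the hyperbolic upper half-plane, at time `t > 0` and
hyperbolic distance `η ≥ 0`. -/
noncomputable def hypHeatKernel (t η : ℝ) : ℝ :=
  (Real.sqrt 2 * Real.exp (-t / 4) / (4 * Real.pi * t) ^ ((3 : ℝ) / 2)) *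
    ∫ r in Set.Ioi η, r * Real.exp (-r ^ 2 / (4 * t)) / Real.sqrt (Real.cosh r - Real.cosh η)

/-- The function `r ↦ r * exp (-r² / (4t))` decreases past its maximum at `√(2t)`. -/
lemma mul_exp_neg_sq_div_le {t a b : ℝ} (ht : 0 < t) (ha : 0 < a) (hta : 2 * t ≤ a ^ 2)
    (hab : a ≤ b) :
    b * Real.exp (-b ^ 2 / (4 * t)) ≤ a * Real.exp (-a ^ 2 / (4 * t)) := by
  have hexp : Real.exp (-a ^ 2 / (4 * t)) =
      Real.exp ((b ^ 2 - a ^ 2) / (4 * t)) * Real.exp (-b ^ 2 / (4 * t)) := by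
    rw [← Real.exp_add]
    congr 1
    ring
  have hlin : b ≤ a * ((b ^ 2 - a ^ 2) / (4 * t) + 1) := by
    have h : b - a ≤ a * (b ^ 2 - a ^ 2) / (4 * t) := by
      rw [le_div_iff₀ (by positivity)]
      nlinarith [mul_le_mul_of_nonneg_left hta (sub_nonneg.2 hab),
        mul_nonneg ha.le (sq_nonneg (b - a))]
    have h' : a * ((b ^ 2 - a ^ 2) / (4 * t) + 1) = a * (b ^ 2 - a ^ 2) / (4 * t) + a := by ring
    linarith
  rw [hexp, ← mul_assoc]
  gcongr
  exact hlin.trans (by gcongr; exact Real.add_one_le_exp _)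

lemma cosh_add_sub_cosh_le {a b s : ℝ} (ha : 0 ≤ a) (hab : a ≤ b) (hs : 0 ≤ s) :
    Real.cosh (a + s) - Real.cosh a ≤ Real.cosh (b + s) - Real.cosh b := by
  have hcosh : Real.cosh a ≤ Real.cosh b := by
    rw [Real.cosh_le_cosh, abs_of_nonneg ha, abs_of_nonneg (ha.trans hab)]
    exact hab
  rw [Real.cosh_add, Real.cosh_add]
  nlinarith [mul_le_mul_of_nonneg_right (Real.sinh_le_sinh.2 hab) (Real.sinh_nonneg_iff.2 hs),
    mul_le_mul_of_nonneg_right hcosh (sub_nonneg.2 (Real.one_le_cosh s))]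

lemma mul_sinh_le_cosh_add_sub_cosh {a s : ℝ} (ha : 0 ≤ a) (hs : 0 ≤ s) :
    s * Real.sinh a ≤ Real.cosh (a + s) - Real.cosh a := by
  rw [Real.cosh_add]
  nlinarith [mul_le_mul_of_nonneg_right (Real.self_le_sinh_iff.2 hs) (Real.sinh_nonneg_iff.2 ha),
    mul_nonneg (Real.cosh_pos a).le (sub_nonneg.2 (Real.one_le_cosh s))]

lemma integrableOn_heatKernel_integrand {t a : ℝ} (ht : 0 < t) (ha : 0 < a) :
    IntegrableOn (fun s => (a + s) * Real.exp (-(a + s) ^ 2 / (4 * t)) /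
      Real.sqrt (Real.cosh (a + s) - Real.cosh a)) (Set.Ioi 0) := by
  have hsinh : 0 < Real.sinh a := Real.sinh_pos_iff.2 ha
  have hb : 0 < 1 / (4 * t) := by positivity
  have hdom := (((integrableOn_rpow_mul_exp_neg_mul_sq hb
    (show (-1 : ℝ) < -1 / 2 by norm_num)).const_mul a).add
    (integrableOn_rpow_mul_exp_neg_mul_sq hb
      (show (-1 : ℝ) < 1 / 2 by norm_num))).div_const (Real.sqrt (Real.sinh a))
  refine Integrable.mono' hdom (Measurable.aestronglyMeasurable (by fun_prop)) ?_
  refine (ae_restrict_iff' measurableSet_Ioi).2 (Filter.Eventually.of_forall fun s hs => ?_)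
  have hs : 0 < s := hs
  rw [Real.norm_of_nonneg (by positivity)]
  have hsqrt : 0 < Real.sqrt s := Real.sqrt_pos.2 hs
  have hneg : s ^ (-1 / 2 : ℝ) = 1 / Real.sqrt s := by
    rw [show (-1 / 2 : ℝ) = -(1 / 2) by norm_num, Real.rpow_neg hs.le, ← Real.sqrt_eq_rpow,
      one_div]
  have hpos : s ^ (1 / 2 : ℝ) = s / Real.sqrt s := by
    rw [← Real.sqrt_eq_rpow, Real.div_sqrt]
  have hexp : Real.exp (-(a + s) ^ 2 / (4 * t)) ≤ Real.exp (-(1 / (4 * t)) * s ^ 2) := by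
    rw [show -(1 / (4 * t)) * s ^ 2 = -s ^ 2 / (4 * t) by ring]
    gcongr
    linarith
  calc _ ≤ (a + s) * Real.exp (-(1 / (4 * t)) * s ^ 2) / Real.sqrt (s * Real.sinh a) := by
        gcongr
        exact mul_sinh_le_cosh_add_sub_cosh ha.le hs.le
    _ = _ := by
        simp only [Pi.add_apply]
        rw [hneg, hpos, Real.sqrt_mul hs.le]
        ring

lemma integral_Ioi_eq_integral_Ioi_zero_comp_add (f : ℝ → ℝ) (a : ℝ) :
    ∫ r in Set.Ioi a, f r = ∫ s in Set.Ioi 0, f (a + s) := by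
  have h := (measurePreserving_add_left volume a).setIntegral_preimage_emb
    (measurableEmbedding_addLeft a) f (Set.Ioi a)
  simpa using h.symm

/-- For every `t₀ > 0` there is `δ₀ > 0` such that for each fixed
`0 < t ≤ t₀`, the function `η ↦ K_ℍ(t; η)` is monotone decreasing on `[δ₀, ∞)`. -/
theorem hypHeatKernel_antitone (t₀ : ℝ) (ht₀ : 0 < t₀) :
    ∃ δ₀ > (0 : ℝ), ∀ t : ℝ, 0 < t → t ≤ t₀ →
      AntitoneOn (fun η => hypHeatKernel t η) (Set.Ici δ₀) := by
  refine ⟨Real.sqrt (2 * t₀), Real.sqrt_pos.2 (by positivity), fun t ht htt a ha b _ hab => ?_⟩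
  have ha' : Real.sqrt (2 * t₀) ≤ a := ha
  have ha0 : 0 < a := (Real.sqrt_pos.2 (by positivity)).trans_le ha'
  have hta : 2 * t ≤ a ^ 2 := by
    have := (Real.sqrt_le_left ha0.le).1 ha'
    linarith
  have hb0 : 0 < b := ha0.trans_le hab
  simp only [hypHeatKernel]
  refine mul_le_mul_of_nonneg_left ?_ (by positivity)
  rw [integral_Ioi_eq_integral_Ioi_zero_comp_add _ a,
    integral_Ioi_eq_integral_Ioi_zero_comp_add _ b]
  refine setIntegral_mono_on (integrableOn_heatKernel_integrand ht hb0)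
    (integrableOn_heatKernel_integrand ht ha0) measurableSet_Ioi fun s hs => ?_
  have hs : 0 < s := hs
  have hden : 0 < Real.cosh (a + s) - Real.cosh a :=
    (mul_pos hs (Real.sinh_pos_iff.2 ha0)).trans_le (mul_sinh_le_cosh_add_sub_cosh ha0.le hs.le)
  exact div_le_div₀ (by positivity)
    (mul_exp_neg_sq_div_le ht (by positivity) (by nlinarith) (by linarith))
    (Real.sqrt_pos.2 hden) (Real.sqrt_le_sqrt (cosh_add_sub_cosh_le ha0.le hab hs.le))
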